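/- Let C143, C231, C234, C344 be arbitrary real numbers. On the 4-dimensional real vector space with basis y1, y2, y3, y4, the skew-symmetric bilinear bracket determined by [y1,y2]=y3, [y1,y3]=y4, [y1,y4]=C143·y3, [y2,y3]=C231·y1 + C344·y2 + C234·y4, [y2,y4]=(C143·C234 + C344)·y3, [y3,y4]=−C143·C231·y1 − C143·C344·y2 + C344·y4 satisfies the Jacobi identity (so it defines a Lie algebra, called ourSolDep[6]), and the 2-dimensional subspace D = span{y1,y2} is an Engel-like structure on it. -/

import Mathlib

/-- Bilinear extension of structure constants `c` to a bracket on `Fin 4 → ℝ`. -/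
noncomputable def bk (c : Fin 4 → Fin 4 → Fin 4 → ℝ) (x y : Fin 4 → ℝ) : Fin 4 → ℝ :=
  ∑ i : Fin 4, ∑ j : Fin 4, (x i * y j) • c i j

/-- Structure constants of the Engel-normalized bracket:
`[y1,y2] = y3`, `[y1,y3] = y4`, `[y1,y4] = C14`, `[y2,y3] = C23`,
`[y2,y4] = C24`, `[y3,y4] = C34`, extended skew-symmetrically. -/
noncomputable def sc (C14 C23 C24 C34 : Fin 4 → ℝ) : Fin 4 → Fin 4 → Fin 4 → ℝ :=
  ![![0, ![0, 0, 1, 0], ![0, 0, 0, 1], C14],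
    ![-![0, 0, 1, 0], 0, C23, C24],
    ![-![0, 0, 0, 1], -C23, 0, C34],
    ![-C14, -C24, -C34, 0]]

/-- The subspace spanned by all brackets `B u v` with `u ∈ S`, `v ∈ T`. -/
noncomputable def brS (B : (Fin 4 → ℝ) → (Fin 4 → ℝ) → (Fin 4 → ℝ))
    (S T : Submodule ℝ (Fin 4 → ℝ)) : Submodule ℝ (Fin 4 → ℝ) :=
  Submodule.span ℝ {z | ∃ u ∈ S, ∃ v ∈ T, z = B u v}

/-- `D` is an Engel-like structure for the bracket `B`: `D` is 2-dimensional,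
`D[2] = D + [D,D]` is 3-dimensional and `D[3] = D[2] + [D[2],D[2]]` is 4-dimensional. -/
noncomputable def IsEngelLike (B : (Fin 4 → ℝ) → (Fin 4 → ℝ) → (Fin 4 → ℝ))
    (D : Submodule ℝ (Fin 4 → ℝ)) : Prop :=
  Module.finrank ℝ D = 2 ∧
  Module.finrank ℝ ↥(D ⊔ brS B D D) = 3 ∧
  Module.finrank ℝ ↥((D ⊔ brS B D D) ⊔ brS B (D ⊔ brS B D D) (D ⊔ brS B D D)) = 4

theorem bk_formula (a b d e : ℝ) (x y : Fin 4 → ℝ) :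
    bk (sc ![0, 0, a, 0] ![b, e, 0, d] ![0, 0, a * d + e, 0] ![-a * b, -a * e, 0, e]) x y =
    ![(x 1 * y 2 - x 2 * y 1) * b - (x 2 * y 3 - x 3 * y 2) * (a * b),
      (x 1 * y 2 - x 2 * y 1) * e - (x 2 * y 3 - x 3 * y 2) * (a * e),
      (x 0 * y 1 - x 1 * y 0) + (x 0 * y 3 - x 3 * y 0) * a
        + (x 1 * y 3 - x 3 * y 1) * (a * d + e),
      (x 0 * y 2 - x 2 * y 0) + (x 1 * y 2 - x 2 * y 1) * d
        + (x 2 * y 3 - x 3 * y 2) * e] := by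
  ext k
  fin_cases k <;> simp [bk, sc, Fin.sum_univ_four] <;> ring

theorem mem_D (v : Fin 4 → ℝ) :
    v ∈ Submodule.span ℝ {(![1, 0, 0, 0] : Fin 4 → ℝ), ![0, 1, 0, 0]} ↔ v 2 = 0 ∧ v 3 = 0 := by
  rw [Submodule.mem_span_pair]
  constructor
  · rintro ⟨p, q, rfl⟩
    simp
  · rintro ⟨h2, h3⟩
    refine ⟨v 0, v 1, ?_⟩
    ext k
    fin_cases k <;> simp [h2, h3]

theorem ourSolDep6_lie_and_engel (C143 C231 C234 C344 : ℝ) :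
    let c := sc ![0, 0, C143, 0]
      ![C231, C344, 0, C234]
      ![0, 0, C143 * C234 + C344, 0]
      ![-C143 * C231, -C143 * C344, 0, C344]
    (∀ x y : Fin 4 → ℝ, bk c x y = -bk c y x) ∧
    (∀ x y z : Fin 4 → ℝ,
      bk c x (bk c y z) + bk c y (bk c z x) + bk c z (bk c x y) = 0) ∧
    IsEngelLike (bk c)
      (Submodule.span ℝ {(![1, 0, 0, 0] : Fin 4 → ℝ), ![0, 1, 0, 0]}) := by
  intro c
  have hB : ∀ x y, bk c x y = _ := bk_formula C143 C231 C234 C344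
  have hD2 : (Submodule.span ℝ {(![1, 0, 0, 0] : Fin 4 → ℝ), ![0, 1, 0, 0]}) ⊔
      brS (bk c) (Submodule.span ℝ {(![1, 0, 0, 0] : Fin 4 → ℝ), ![0, 1, 0, 0]})
        (Submodule.span ℝ {(![1, 0, 0, 0] : Fin 4 → ℝ), ![0, 1, 0, 0]}) =
      Submodule.span ℝ (Set.range ![(![1, 0, 0, 0] : Fin 4 → ℝ), ![0, 1, 0, 0], ![0, 0, 1, 0]]) := by
    apply le_antisymm
    · refine sup_le (Submodule.span_mono ?_) (Submodule.span_le.2 ?_)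
      · rintro v (rfl | rfl)
        · exact ⟨0, rfl⟩
        · exact ⟨1, rfl⟩
      · rintro z ⟨u, hu, v, hv, rfl⟩
        rw [mem_D] at hu hv
        have : bk c u v = (u 0 * v 1 - u 1 * v 0) • (![0, 0, 1, 0] : Fin 4 → ℝ) := by
          rw [hB]
          ext k
          fin_cases k <;> simp [hu.1, hu.2, hv.1, hv.2]
        rw [this]
        exact Submodule.smul_mem _ _ (Submodule.subset_span ⟨2, rfl⟩)
    · refine Submodule.span_le.2 ?_
      rintro _ ⟨i, rfl⟩
      fin_cases i
      · exact Submodule.mem_sup_left (Submodule.subset_span (by simp))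
      · exact Submodule.mem_sup_left (Submodule.subset_span (by simp))
      · refine Submodule.mem_sup_right (Submodule.subset_span
          ⟨![1, 0, 0, 0], (mem_D _).2 (by simp), ![0, 1, 0, 0], (mem_D _).2 (by simp), ?_⟩)
        rw [hB]
        ext k
        fin_cases k <;> simp
  refine ⟨?_, ?_, ?_, ?_, ?_⟩
  · intro x y
    rw [hB, hB]
    ext k
    fin_cases k <;> simp <;> ring
  · intro x y z
    simp only [hB]
    ext k
    fin_cases k <;> simp <;> ring
  · have h : LinearIndependent ℝ ![(![1, 0, 0, 0] : Fin 4 → ℝ), ![0, 1, 0, 0]] := by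
      rw [Fintype.linearIndependent_iff]
      intro g hg i
      have h0 := congrFun hg 0
      have h1 := congrFun hg 1
      simp [Fin.sum_univ_succ] at h0 h1
      fin_cases i <;> simp [h0, h1]
    have := finrank_span_eq_card h
    rw [Matrix.range_cons_cons_empty] at this
    rw [this]
    simp
  · rw [hD2]
    have h : LinearIndependent ℝ
        ![(![1, 0, 0, 0] : Fin 4 → ℝ), ![0, 1, 0, 0], ![0, 0, 1, 0]] := by
      rw [Fintype.linearIndependent_iff]
      intro g hg i
      have h0 := congrFun hg 0
      have h1 := congrFun hg 1
      have h2 := congrFun hg 2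
      simp [Fin.sum_univ_succ] at h0 h1 h2
      fin_cases i <;> simp [h0, h1, h2]
    have := finrank_span_eq_card h
    rw [this]
    simp
  · rw [hD2]
    set S := Submodule.span ℝ
      (Set.range ![(![1, 0, 0, 0] : Fin 4 → ℝ), ![0, 1, 0, 0], ![0, 0, 1, 0]]) with hS
    have e0 : (![1, 0, 0, 0] : Fin 4 → ℝ) ∈ S := Submodule.subset_span ⟨0, rfl⟩
    have e1 : (![0, 1, 0, 0] : Fin 4 → ℝ) ∈ S := Submodule.subset_span ⟨1, rfl⟩
    have e2 : (![0, 0, 1, 0] : Fin 4 → ℝ) ∈ S := Submodule.subset_span ⟨2, rfl⟩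
    have e3 : (![0, 0, 0, 1] : Fin 4 → ℝ) ∈ brS (bk c) S S := by
      refine Submodule.subset_span ⟨_, e0, _, e2, ?_⟩
      rw [hB]
      ext k
      fin_cases k <;> simp
    have ht : S ⊔ brS (bk c) S S = ⊤ := by
      rw [eq_top_iff]
      intro v _
      have : v = (v 0 • (![1, 0, 0, 0] : Fin 4 → ℝ) + v 1 • (![0, 1, 0, 0] : Fin 4 → ℝ)
          + v 2 • (![0, 0, 1, 0] : Fin 4 → ℝ)) + v 3 • (![0, 0, 0, 1] : Fin 4 → ℝ) := by
        ext k
        fin_cases k <;> simp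
      rw [this]
      exact Submodule.add_mem_sup
        (S.add_mem (S.add_mem (S.smul_mem _ e0) (S.smul_mem _ e1)) (S.smul_mem _ e2))
        (Submodule.smul_mem _ _ e3)
    rw [ht, finrank_top]
    simp
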